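/- arXiv:1303.1163 — 2 statements merged into one kernel-verified Lean document; each statement's English description precedes it below -/
import Mathlib

section
/- Suppose {a_i}_{i=1}^k is a tight frame set for H_n. For q with 1 ≤ q ≤ min(k−1, n−1), let m_q := max_{q+1 ≤ i ≤ k} a_i². Then m_q ≤ (1/(n−q)) Σ_{i=q+1}^k a_i². In particular, for k ≥ 2 and n ≥ 2, n·m_1 − Σ_{i=2}^k a_i² ≤ m_1 ≤ (1/(n−1)) Σ_{i=2}^k a_i². -/
open scoped InnerProductSpace

/-- A finite family of nonnegative numbers `a` is a tight frame set for `H` if there is a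
tight frame `f` for `H` with `‖f i‖ = a i` for all `i`. -/
def IsTightFrameSet (𝕜 : Type*) [RCLike 𝕜] (H : Type*) [NormedAddCommGroup H]
    [InnerProductSpace 𝕜 H] {ι : Type*} [Fintype ι] (a : ι → ℝ) : Prop :=
  ∃ f : ι → H,
    (∃ μ : ℝ, 0 < μ ∧ ∀ v : H, ∑ i, ‖⟪v, f i⟫_𝕜‖ ^ 2 = μ * ‖v‖ ^ 2) ∧
    ∀ i, ‖f i‖ = a i

section TightFrame

variable {𝕜 : Type*} [RCLike 𝕜] {H : Type*} [NormedAddCommGroup H] [InnerProductSpace 𝕜 H]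
  {ι : Type*} [Fintype ι] {f : ι → H} {μ : ℝ}

/-- The squared norm of each vector of a tight frame is at most the frame bound. -/
theorem norm_sq_le_of_tightFrame (hμ : 0 ≤ μ)
    (hf : ∀ v : H, ∑ i, ‖⟪v, f i⟫_𝕜‖ ^ 2 = μ * ‖v‖ ^ 2) (j : ι) : ‖f j‖ ^ 2 ≤ μ := by
  rcases (sq_nonneg ‖f j‖).eq_or_lt with h0 | hpos
  · exact h0 ▸ hμ
  · refine le_of_mul_le_mul_right ?_ hpos
    calc ‖f j‖ ^ 2 * ‖f j‖ ^ 2 = ‖⟪f j, f j⟫_𝕜‖ ^ 2 := by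
          rw [inner_self_eq_norm_sq_to_K, norm_pow, RCLike.norm_ofReal, abs_norm]
          ring
      _ ≤ ∑ i, ‖⟪f j, f i⟫_𝕜‖ ^ 2 :=
          Finset.single_le_sum (f := fun i => ‖⟪f j, f i⟫_𝕜‖ ^ 2)
            (fun i _ => sq_nonneg _) (Finset.mem_univ j)
      _ = μ * ‖f j‖ ^ 2 := hf (f j)

/-- The squared norms of a tight frame add up to the dimension times the frame bound. -/
theorem sum_norm_sq_of_tightFrame [FiniteDimensional 𝕜 H]
    (hf : ∀ v : H, ∑ i, ‖⟪v, f i⟫_𝕜‖ ^ 2 = μ * ‖v‖ ^ 2) :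
    ∑ i, ‖f i‖ ^ 2 = Module.finrank 𝕜 H * μ := by
  let b := stdOrthonormalBasis 𝕜 H
  calc ∑ i, ‖f i‖ ^ 2 = ∑ i, ∑ j, ‖⟪b j, f i⟫_𝕜‖ ^ 2 :=
        Finset.sum_congr rfl fun i _ => (b.sum_sq_norm_inner_right (f i)).symm
    _ = ∑ j, ∑ i, ‖⟪b j, f i⟫_𝕜‖ ^ 2 := Finset.sum_comm
    _ = Module.finrank 𝕜 H * μ := by simp [hf]

end TightFrame

/-- In a tight frame set, each square is controlled by the sum of squares left after removing
at most `q` members, where `q` is at most the dimension. -/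
theorem IsTightFrameSet.sub_mul_sq_le_sum {𝕜 : Type*} [RCLike 𝕜] {H : Type*}
    [NormedAddCommGroup H] [InnerProductSpace 𝕜 H] [FiniteDimensional 𝕜 H]
    {ι : Type*} [Fintype ι] [DecidableEq ι] {a : ι → ℝ} (ha : IsTightFrameSet 𝕜 H a)
    (s : Finset ι) {q : ℕ} (hs : sᶜ.card ≤ q) (hq : q ≤ Module.finrank 𝕜 H) (j : ι) :
    ((Module.finrank 𝕜 H : ℝ) - q) * a j ^ 2 ≤ ∑ i ∈ s, a i ^ 2 := by
  obtain ⟨f, ⟨μ, hμ, hf⟩, hfa⟩ := ha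
  have hle : ∀ i, a i ^ 2 ≤ μ := fun i => hfa i ▸ norm_sq_le_of_tightFrame hμ.le hf i
  have hsum : ∑ i, a i ^ 2 = Module.finrank 𝕜 H * μ := by
    simpa only [hfa] using sum_norm_sq_of_tightFrame hf
  have hcompl : ∑ i ∈ sᶜ, a i ^ 2 ≤ q * μ :=
    calc ∑ i ∈ sᶜ, a i ^ 2 ≤ sᶜ.card * μ := by
          simpa using Finset.sum_le_card_nsmul sᶜ _ μ fun i _ => hle i
      _ ≤ q * μ := by gcongr
  have hq' : (0 : ℝ) ≤ (Module.finrank 𝕜 H : ℝ) - q := sub_nonneg.2 (by exact_mod_cast hq)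
  have hmul := mul_le_mul_of_nonneg_left (hle j) hq'
  have hsplit := Finset.sum_add_sum_compl s fun i => a i ^ 2
  linarith

/-- if `{a i}_{i=1}^k` is a tight frame set for an `n`-dimensional Hilbert
space `H` (with `n, k ≥ 2`), then for each `1 ≤ q ≤ min (k-1) (n-1)`, the maximum
`m_q = max_{q+1 ≤ i ≤ k} (a i)²` satisfies `m_q ≤ (1/(n-q)) ∑_{i=q+1}^k (a i)²`; in
particular `n * m_1 - ∑_{i=2}^k (a i)² ≤ m_1 ≤ (1/(n-1)) ∑_{i=2}^k (a i)²`.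
(Indices of `a : Fin k → ℝ` are 0-based, so "`q+1 ≤ i ≤ k`" reads "`q ≤ i`".) -/
theorem stmt17 {𝕜 : Type*} [RCLike 𝕜] {H : Type*} [NormedAddCommGroup H]
    [InnerProductSpace 𝕜 H] [FiniteDimensional 𝕜 H] {n k : ℕ}
    (hfin : Module.finrank 𝕜 H = n) (hn : 2 ≤ n) (hk : 2 ≤ k)
    (a : Fin k → ℝ) (hTFS : IsTightFrameSet 𝕜 H a) :
    (∀ q : ℕ, 1 ≤ q → q ≤ min (k - 1) (n - 1) →
      sSup {x : ℝ | ∃ i : Fin k, q ≤ (i : ℕ) ∧ x = a i ^ 2} ≤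
        (1 / ((n : ℝ) - q)) * ∑ i ∈ Finset.univ.filter (fun i : Fin k => q ≤ (i : ℕ)),
          a i ^ 2) ∧
    ((n : ℝ) * sSup {x : ℝ | ∃ i : Fin k, 1 ≤ (i : ℕ) ∧ x = a i ^ 2} -
        ∑ i ∈ Finset.univ.filter (fun i : Fin k => 1 ≤ (i : ℕ)), a i ^ 2 ≤
          sSup {x : ℝ | ∃ i : Fin k, 1 ≤ (i : ℕ) ∧ x = a i ^ 2} ∧
      sSup {x : ℝ | ∃ i : Fin k, 1 ≤ (i : ℕ) ∧ x = a i ^ 2} ≤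
        (1 / ((n : ℝ) - 1)) *
          ∑ i ∈ Finset.univ.filter (fun i : Fin k => 1 ≤ (i : ℕ)), a i ^ 2) := by
  subst hfin
  have key : ∀ q : ℕ, 1 ≤ q → q ≤ min (k - 1) (Module.finrank 𝕜 H - 1) →
      sSup {x : ℝ | ∃ i : Fin k, q ≤ (i : ℕ) ∧ x = a i ^ 2} ≤
        (1 / ((Module.finrank 𝕜 H : ℝ) - q)) *
          ∑ i ∈ Finset.univ.filter (fun i : Fin k => q ≤ (i : ℕ)), a i ^ 2 := by
    intro q _ hq
    have hqk : q < k := by omega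
    have hqn : q < Module.finrank 𝕜 H := by omega
    have hpos : (0 : ℝ) < (Module.finrank 𝕜 H : ℝ) - q := sub_pos.2 (by exact_mod_cast hqn)
    refine csSup_le ⟨_, ⟨q, hqk⟩, le_rfl, rfl⟩ ?_
    rintro _ ⟨j, -, rfl⟩
    rw [one_div, inv_mul_eq_div, le_div_iff₀' hpos]
    refine hTFS.sub_mul_sq_le_sum _ ?_ hqn.le j
    rw [Finset.compl_filter]
    simp [Fin.card_filter_val_lt]
  have h1 := key 1 le_rfl (by omega)
  rw [Nat.cast_one] at h1
  refine ⟨key, ?_, h1⟩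
  have hpos : (0 : ℝ) < (Module.finrank 𝕜 H : ℝ) - 1 := sub_pos.2 (by exact_mod_cast hn)
  rw [one_div, inv_mul_eq_div, le_div_iff₀' hpos] at h1
  linarith
end

section
/- Let n ≥ 2, 0 ≤ p ≤ k − 1, 0 ≤ q ≤ n − 1, and let {a_i}_{i=1}^k be a sequence of positive scalars. Then a (p,q)-length surgery on {a_i}_{i=1}^k resulting in a tight frame set for H_n is possible if and only if there exists a subset {b_j}_{j=1}^{k−p} of {a_i}_{i=1}^k of size k − p such that max_{1 ≤ j ≤ k−p} b_j² ≤ (1/(n−q)) Σ_{j=1}^{k−p} b_j². -/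
open scoped InnerProductSpace

lemma norm_sq_rotate {𝕜 : Type*} [RCLike 𝕜] {E : Type*} [NormedAddCommGroup E]
    [InnerProductSpace 𝕜 E] (u w : E) {c s : ℝ} (h : c ^ 2 + s ^ 2 = 1) :
    ‖(c : 𝕜) • u + (s : 𝕜) • w‖ ^ 2 + ‖(c : 𝕜) • w - (s : 𝕜) • u‖ ^ 2 = ‖u‖ ^ 2 + ‖w‖ ^ 2 := by
  rw [norm_add_sq (𝕜 := 𝕜), norm_sub_sq (𝕜 := 𝕜)]
  simp only [norm_smul, inner_smul_left, inner_smul_right, RCLike.conj_ofReal, mul_pow,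
    RCLike.norm_ofReal, sq_abs, RCLike.re_ofReal_mul]
  rw [inner_re_symm w u]
  linear_combination (‖u‖ ^ 2 + ‖w‖ ^ 2) * h

/-- A family `f` satisfies Parseval's identity and has prescribed squared norms `d`. -/
def IsParsevalWithSqNorms (𝕜 : Type*) [RCLike 𝕜] {H : Type*} [NormedAddCommGroup H]
    [InnerProductSpace 𝕜 H] {ι : Type*} [Fintype ι] (d : ι → ℝ) (f : ι → H) : Prop :=
  (∀ v : H, ∑ i, ‖⟪v, f i⟫_𝕜‖ ^ 2 = ‖v‖ ^ 2) ∧ ∀ i, ‖f i‖ ^ 2 = d i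

section

variable {𝕜 : Type*} [RCLike 𝕜] {H : Type*} [NormedAddCommGroup H] [InnerProductSpace 𝕜 H]
  {ι : Type*} [Fintype ι]

/-- Rotating the vectors at `i` and `j` realizes every squared norm between the two given ones. -/
lemma IsParsevalWithSqNorms.exists_rotate {d d' : ι → ℝ} {f : ι → H}
    (hf : IsParsevalWithSqNorms 𝕜 d' f) {i j : ι} (hij : i ≠ j)
    (hd : ∀ l, l ≠ i → l ≠ j → d l = d' l) (hsum : d i + d j = d' i + d' j)
    (hj : d' j ≤ d i) (hi : d i ≤ d' i) : ∃ g : ι → H, IsParsevalWithSqNorms 𝕜 d g := by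
  classical
  obtain ⟨t, ht⟩ : ∃ t : ℝ,
      ‖((Real.cos t : ℝ) : 𝕜) • f i + ((Real.sin t : ℝ) : 𝕜) • f j‖ ^ 2 = d i := by
    apply mem_range_of_exists_le_of_exists_ge (f := fun t : ℝ =>
      ‖((Real.cos t : ℝ) : 𝕜) • f i + ((Real.sin t : ℝ) : 𝕜) • f j‖ ^ 2)
    · have h1 : Continuous fun t : ℝ => ((Real.cos t : ℝ) : 𝕜) :=
        RCLike.continuous_ofReal.comp Real.continuous_cos
      have h2 : Continuous fun t : ℝ => ((Real.sin t : ℝ) : 𝕜) :=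
        RCLike.continuous_ofReal.comp Real.continuous_sin
      fun_prop
    · exact ⟨Real.pi / 2, by simpa [hf.2] using hj⟩
    · exact ⟨0, by simpa [hf.2] using hi⟩
  set c := Real.cos t
  set s := Real.sin t
  have hcs : c ^ 2 + s ^ 2 = 1 := Real.cos_sq_add_sin_sq t
  set g : ι → H := fun l => if l = i then (c : 𝕜) • f i + (s : 𝕜) • f j
    else if l = j then (c : 𝕜) • f j - (s : 𝕜) • f i else f l with hg
  have gi : g i = (c : 𝕜) • f i + (s : 𝕜) • f j := by simp [hg]
  have gj : g j = (c : 𝕜) • f j - (s : 𝕜) • f i := by simp [hg, hij.symm]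
  have gl : ∀ l, l ≠ i → l ≠ j → g l = f l := fun l h1 h2 => by simp [hg, h1, h2]
  refine ⟨g, fun v => ?_, fun l => ?_⟩
  · rw [← hf.1 v, ← sub_eq_zero, ← Finset.sum_sub_distrib,
      ← Finset.sum_subset (Finset.subset_univ {i, j}), Finset.sum_pair hij, gi, gj]
    · have := norm_sq_rotate (𝕜 := 𝕜) ⟪v, f i⟫_𝕜 ⟪v, f j⟫_𝕜 hcs
      simp only [smul_eq_mul] at this
      simp only [inner_add_right, inner_sub_right, inner_smul_right]
      linarith
    · intro l _ hl
      simp only [Finset.mem_insert, Finset.mem_singleton, not_or] at hl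
      rw [gl l hl.1 hl.2, sub_self]
  · by_cases h1 : l = i
    · rw [h1, gi, ht]
    by_cases h2 : l = j
    · have := norm_sq_rotate (𝕜 := 𝕜) (f i) (f j) hcs
      rw [h2, gj]
      linarith [hf.2 i, hf.2 j]
    · rw [gl l h1 h2, hf.2, hd l h1 h2]

lemma exists_isParsevalWithSqNorms_of_zero_or_one [FiniteDimensional 𝕜 H] (d : ι → ℝ)
    (hd : ∀ i, d i = 0 ∨ d i = 1) (hsum : ∑ i, d i = Module.finrank 𝕜 H) :
    ∃ f : ι → H, IsParsevalWithSqNorms 𝕜 d f := by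
  classical
  set T := Finset.univ.filter fun i => d i = 1 with hT
  have hd' : ∀ i, d i = if i ∈ T then 1 else 0 := by
    intro i
    rcases hd i with h | h <;> simp [hT, h]
  have hcard : Module.finrank 𝕜 H = Fintype.card T := by
    have : (Module.finrank 𝕜 H : ℝ) = T.card := by
      rw [← hsum, Finset.sum_congr rfl fun i _ => hd' i]
      simp
    rw [Fintype.card_coe]
    exact_mod_cast this
  let b : OrthonormalBasis T 𝕜 H :=
    (stdOrthonormalBasis 𝕜 H).reindex (Fintype.equivOfCardEq (by simpa using hcard))
  refine ⟨fun i => if h : i ∈ T then b ⟨i, h⟩ else 0, fun v => ?_, fun i => ?_⟩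
  · rw [← b.sum_sq_norm_inner_left v, ← Finset.sum_subset (Finset.subset_univ T),
      ← Finset.sum_coe_sort T]
    · simp
    · intro i _ hi
      simp [hi]
  · rw [hd' i]
    by_cases h : i ∈ T <;> simp [h]

/-- The carpenter's theorem: every `d` with values in `[0, 1]` whose sum is the dimension is the
family of squared norms of a Parseval frame. -/
theorem exists_isParsevalWithSqNorms [FiniteDimensional 𝕜 H] (d : ι → ℝ)
    (h0 : ∀ i, 0 ≤ d i) (h1 : ∀ i, d i ≤ 1) (hsum : ∑ i, d i = Module.finrank 𝕜 H) :
    ∃ f : ι → H, IsParsevalWithSqNorms 𝕜 d f := by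
  classical
  induction hN : (Finset.univ.filter fun i => d i ≠ 0 ∧ d i ≠ 1).card using Nat.strong_induction_on
    generalizing d with
  | _ N ih =>
  subst hN
  by_cases hint : ∀ i, d i = 0 ∨ d i = 1
  · exact exists_isParsevalWithSqNorms_of_zero_or_one d hint hsum
  push Not at hint
  obtain ⟨i, hi0, hi1⟩ := hint
  obtain ⟨j, hji, hj0, hj1⟩ : ∃ j, j ≠ i ∧ d j ≠ 0 ∧ d j ≠ 1 := by
    by_contra! hcon
    have hrest : ∑ l ∈ Finset.univ.erase i, d l ∈ (Int.castRingHom ℝ).range := by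
      refine sum_mem fun l hl => ?_
      by_cases h : d l = 0
      · rw [h]
        exact zero_mem _
      · rw [hcon l (Finset.ne_of_mem_erase hl) h]
        exact one_mem _
    obtain ⟨z, hz⟩ := hrest
    have hs := Finset.add_sum_erase Finset.univ d (Finset.mem_univ i)
    rw [hsum, ← hz, eq_intCast] at hs
    have hdi : d i = ((Module.finrank 𝕜 H - z : ℤ) : ℝ) := by
      push_cast
      linarith
    have hpos : (0 : ℝ) < ((Module.finrank 𝕜 H - z : ℤ) : ℝ) := hdi ▸ (h0 i).lt_of_ne' hi0
    have hlt : ((Module.finrank 𝕜 H - z : ℤ) : ℝ) < ((1 : ℤ) : ℝ) := by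
      rw [← hdi, Int.cast_one]
      exact (h1 i).lt_of_ne hi1
    have hpos' := Int.cast_pos.mp hpos
    have hlt' := Int.cast_lt.mp hlt
    omega
  set A := min (d i + d j) 1 with hA
  set B := max 0 (d i + d j - 1) with hB
  have hAB : A + B = d i + d j := by
    rcases le_total (d i + d j) 1 with h | h
    · rw [hA, hB, min_eq_left h, max_eq_left (by linarith), add_zero]
    · rw [hA, hB, min_eq_right h, max_eq_right (by linarith)]
      ring
  have hAB' : A = 1 ∨ B = 0 := by
    rcases le_total (d i + d j) 1 with h | h
    · exact .inr (max_eq_left (by linarith))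
    · exact .inl (min_eq_right h)
  have hiA : d i ≤ A := le_min (by linarith [h0 j]) (h1 i)
  have hBi : B ≤ d i := max_le (h0 i) (by linarith [h1 j])
  set d' : ι → ℝ := Function.update (Function.update d i A) j B with hd'
  have d'i : d' i = A := by simp [hd', hji.symm]
  have d'j : d' j = B := by simp [hd']
  have d'l : ∀ l, l ≠ i → l ≠ j → d' l = d l := fun l h1 h2 => by simp [hd', h1, h2]
  have cases_ij : ∀ P : ι → Prop, P i → P j → (∀ l, l ≠ i → l ≠ j → P l) → ∀ l, P l := by
    intro P h1 h2 h3 l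
    by_cases hli : l = i
    · exact hli ▸ h1
    by_cases hlj : l = j
    · exact hlj ▸ h2
    · exact h3 l hli hlj
  have key : ∃ f : ι → H, IsParsevalWithSqNorms 𝕜 d' f := by
    refine ih _ ?_ d' ?_ ?_ ?_ rfl
    · refine Finset.card_lt_card (Finset.ssubset_iff_of_subset ?_ |>.mpr ?_)
      · intro l
        simp only [Finset.mem_filter, Finset.mem_univ, true_and]
        revert l
        refine cases_ij _ (fun _ => ⟨hi0, hi1⟩) (fun _ => ⟨hj0, hj1⟩) fun l hli hlj => ?_
        rw [d'l l hli hlj]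
        exact id
      · rcases hAB' with h | h
        · exact ⟨i, by simp [hi0, hi1], by simp [d'i, h]⟩
        · exact ⟨j, by simp [hj0, hj1], by simp [d'j, h]⟩
    · refine cases_ij _ ?_ ?_ fun l hli hlj => ?_
      · rw [d'i]
        exact (h0 i).trans hiA
      · rw [d'j]
        exact le_max_left _ _
      · rw [d'l l hli hlj]
        exact h0 l
    · refine cases_ij _ ?_ ?_ fun l hli hlj => ?_
      · rw [d'i]
        exact min_le_right _ _
      · rw [d'j]
        exact hBi.trans (h1 i)
      · rw [d'l l hli hlj]
        exact h1 l
    · rw [← hsum, ← sub_eq_zero, ← Finset.sum_sub_distrib,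
        ← Finset.sum_subset (Finset.subset_univ {i, j}), Finset.sum_pair hji.symm, d'i, d'j]
      · linarith
      · intro l _ hl
        simp only [Finset.mem_insert, Finset.mem_singleton, not_or] at hl
        rw [d'l l hl.1 hl.2, sub_self]
  obtain ⟨f, hf⟩ := key
  exact hf.exists_rotate hji.symm (fun l h1 h2 => (d'l l h1 h2).symm)
    (by rw [d'i, d'j, hAB]) (d'j ▸ hBi) (d'i ▸ hiA)

lemma isTightFrameSet_of_sq_le [FiniteDimensional 𝕜 H] (a : ι → ℝ) {μ : ℝ} (hμ : 0 < μ)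
    (h0 : ∀ i, 0 ≤ a i) (hle : ∀ i, a i ^ 2 ≤ μ) (hsum : ∑ i, a i ^ 2 = Module.finrank 𝕜 H * μ) :
    IsTightFrameSet 𝕜 H a := by
  obtain ⟨f, hf, hnorm⟩ := exists_isParsevalWithSqNorms (𝕜 := 𝕜) (H := H) (fun i => a i ^ 2 / μ)
    (fun i => by positivity) (fun i => (div_le_one hμ).mpr (hle i))
    (by rw [← Finset.sum_div, hsum, mul_div_cancel_right₀ _ hμ.ne'])
  refine ⟨fun i => ((√μ : ℝ) : 𝕜) • f i, ⟨μ, hμ, fun v => ?_⟩, fun i => ?_⟩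
  · rw [← hf v, Finset.mul_sum]
    refine Finset.sum_congr rfl fun i _ => ?_
    rw [inner_smul_right, norm_mul, mul_pow, RCLike.norm_ofReal, sq_abs, Real.sq_sqrt hμ.le]
  · rw [← sq_eq_sq₀ (norm_nonneg _) (h0 i), norm_smul, mul_pow, RCLike.norm_ofReal, sq_abs,
      Real.sq_sqrt hμ.le, hnorm, mul_div_cancel₀ _ hμ.ne']

lemma norm_sq_le_of_tight {f : ι → H} {μ : ℝ}
    (hf : ∀ v : H, ∑ i, ‖⟪v, f i⟫_𝕜‖ ^ 2 = μ * ‖v‖ ^ 2) (hμ : 0 ≤ μ) (i : ι) :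
    ‖f i‖ ^ 2 ≤ μ := by
  rcases eq_or_ne (f i) 0 with h | h
  · simpa [h] using hμ
  have hle := Finset.single_le_sum (f := fun l => ‖⟪f i, f l⟫_𝕜‖ ^ 2)
    (fun l _ => by positivity) (Finset.mem_univ i)
  simp only [hf, inner_self_eq_norm_sq_to_K, norm_pow, RCLike.norm_ofReal, abs_norm] at hle
  have hpos : 0 < ‖f i‖ ^ 2 := by positivity
  exact le_of_mul_le_mul_right (by rwa [← sq]) hpos

/-- In a `μ`-tight frame, discarding a finite subfamily indexed by `κ` leaves vectors whose squared
norms sum to at least `μ` times the dimension minus the number of discarded vectors. -/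
lemma mul_finrank_sub_card_le_of_tight [FiniteDimensional 𝕜 H] {κ : Type*} [Fintype κ]
    {f : ι ⊕ κ → H} {μ : ℝ} (hf : ∀ v : H, ∑ i, ‖⟪v, f i⟫_𝕜‖ ^ 2 = μ * ‖v‖ ^ 2) (hμ : 0 ≤ μ) :
    μ * ((Module.finrank 𝕜 H : ℝ) - Fintype.card κ) ≤ ∑ i, ‖f (.inl i)‖ ^ 2 := by
  set W := Submodule.span 𝕜 (Set.range fun j => f (.inr j))
  set e := stdOrthonormalBasis 𝕜 Wᗮ
  have hdim : (Module.finrank 𝕜 H : ℝ) - Fintype.card κ ≤ Module.finrank 𝕜 Wᗮ := by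
    have h1 : Module.finrank 𝕜 W ≤ Fintype.card κ := finrank_range_le_card _
    have h2 := W.finrank_add_finrank_orthogonal
    rw [sub_le_iff_le_add]
    exact_mod_cast (by omega : Module.finrank 𝕜 H ≤ Module.finrank 𝕜 Wᗮ + Fintype.card κ)
  have he : Orthonormal 𝕜 fun l => (e l : H) :=
    e.orthonormal.comp_linearIsometry Wᗮ.subtypeₗᵢ
  have hzero : ∀ l j, ⟪(e l : H), f (.inr j)⟫_𝕜 = 0 := fun l j =>
    Submodule.inner_left_of_mem_orthogonal (Submodule.subset_span (Set.mem_range_self j)) (e l).2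
  have hone : ∀ l, ∑ i, ‖⟪(e l : H), f (.inl i)⟫_𝕜‖ ^ 2 = μ := by
    intro l
    have := hf (e l)
    rw [Fintype.sum_sum_type, he.norm_eq_one l] at this
    simpa [hzero] using this
  calc μ * ((Module.finrank 𝕜 H : ℝ) - Fintype.card κ) ≤ μ * Module.finrank 𝕜 Wᗮ :=
        mul_le_mul_of_nonneg_left hdim hμ
    _ = ∑ l, ∑ i, ‖⟪(e l : H), f (.inl i)⟫_𝕜‖ ^ 2 := by
        simp only [hone, Finset.sum_const, Finset.card_univ, Fintype.card_fin, nsmul_eq_mul,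
          mul_comm]
    _ = ∑ i, ∑ l, ‖⟪(e l : H), f (.inl i)⟫_𝕜‖ ^ 2 := Finset.sum_comm
    _ ≤ ∑ i, ‖f (.inl i)‖ ^ 2 :=
        Finset.sum_le_sum fun i _ => he.sum_inner_products_le _

end

/-- let `n ≥ 2`, `1 ≤ k`, `p ≤ k - 1`, `q ≤ n - 1`, and let
`a 1, ..., a k > 0`.  A `(p, q)`-length surgery on `{a i}` resulting in a tight frame set
for the `n`-dimensional Hilbert space `H` is possible (i.e. one can keep some `k - p` of
the `a i` and adjoin `q` nonnegative numbers so that the resulting family of `k - p + q`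
numbers is a tight frame set for `H`) iff there is a subset `{b j}_{j=1}^{k-p}` of the
`a i` of size `k - p` with `max_j (b j)² ≤ (1/(n-q)) ∑_j (b j)²`. -/
theorem stmt19 {𝕜 : Type*} [RCLike 𝕜] {H : Type*} [NormedAddCommGroup H]
    [InnerProductSpace 𝕜 H] [FiniteDimensional 𝕜 H] {n k p q : ℕ}
    (hfin : Module.finrank 𝕜 H = n) (hn : 2 ≤ n) (hk : 1 ≤ k)
    (hp : p ≤ k - 1) (hq : q ≤ n - 1) (a : Fin k → ℝ) (ha : ∀ i, 0 < a i) :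
    (∃ (J : Finset (Fin k)) (c : Fin q → ℝ), J.card = k - p ∧ (∀ j, 0 ≤ c j) ∧
        IsTightFrameSet 𝕜 H (Sum.elim (fun i : {x // x ∈ J} => a i) c)) ↔
      ∃ J : Finset (Fin k), J.card = k - p ∧
        ∀ j ∈ J, a j ^ 2 ≤ (1 / ((n : ℝ) - q)) * ∑ i ∈ J, a i ^ 2 := by
  have hm : (0 : ℝ) < (n : ℝ) - q := by
    rw [sub_pos]
    exact_mod_cast (by omega : q < n)
  constructor
  · rintro ⟨J, c, hJ, -, f, ⟨μ, hμ, hf⟩, hnorm⟩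
    refine ⟨J, hJ, fun j hj => ?_⟩
    have h1 := norm_sq_le_of_tight hf hμ.le (.inl ⟨j, hj⟩)
    have h2 := mul_finrank_sub_card_le_of_tight hf hμ.le
    simp only [hnorm, Sum.elim_inl, hfin, Fintype.card_fin] at h1 h2
    rw [Finset.sum_coe_sort J (fun i => a i ^ 2)] at h2
    rw [one_div_mul_eq_div]
    exact h1.trans ((le_div_iff₀ hm).mpr h2)
  · rintro ⟨J, hJ, hle⟩
    set μ := (1 / ((n : ℝ) - q)) * ∑ i ∈ J, a i ^ 2 with hμdef
    have hJne : J.Nonempty := Finset.card_pos.mp (by omega)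
    have hμ : 0 < μ :=
      mul_pos (one_div_pos.mpr hm) (Finset.sum_pos (fun i _ => pow_pos (ha i) 2) hJne)
    refine ⟨J, fun _ => √μ, hJ, fun _ => Real.sqrt_nonneg _,
      isTightFrameSet_of_sq_le _ hμ ?_ ?_ ?_⟩
    · rintro (i | j)
      · exact (ha i).le
      · exact Real.sqrt_nonneg _
    · rintro (i | j)
      · exact hle i i.2
      · exact (Real.sq_sqrt hμ.le).le
    · have hS : ∑ i ∈ J, a i ^ 2 = ((n : ℝ) - q) * μ := by
        rw [hμdef, ← mul_assoc, mul_one_div_cancel hm.ne', one_mul]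
      simp only [Fintype.sum_sum_type, Sum.elim_inl, Sum.elim_inr, Real.sq_sqrt hμ.le, hfin]
      rw [Finset.sum_coe_sort J (fun i => a i ^ 2), hS]
      simp only [Finset.sum_const, Finset.card_univ, Fintype.card_fin, nsmul_eq_mul]
      ring
end
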